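/- Fix A ∈ ℝ^{m×n} and sketch size parameters k, ℓ with k ≤ min(m,n), ℓ ≤ m, and ℓ > k + 1. Let Ω ∈ ℝ^{n×k} and Ψ ∈ ℝ^{ℓ×m} be independent real standard normal random matrices. Let Q = Q(Ω) ∈ ℝ^{m×k} be a measurable function of Ω such that Q has orthonormal columns (QᵀQ = I_k) and the column space of Q contains the column space of AΩ, and define (almost surely) X := ((ΨQ)ᵀ(ΨQ))⁻¹(ΨQ)ᵀ Ψ A = (ΨQ)† Ψ A and the approximation Â := QX. Then for every natural number ϱ with ϱ < k − 1, E ‖A − Â‖_F² ≤ (1 + k/(ℓ − k − 1)) · (1 + ϱ/(k − ϱ − 1)) · τ_{ϱ+1}(A)². (Theorem 4.1, Frobenius-norm error of the sketched low-rank approximation, real case.) -/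

import Mathlib

open Matrix MeasureTheory ProbabilityTheory

/-- Squared Frobenius norm of a real matrix. -/
noncomputable def frobSq {m n : ℕ} (M : Matrix (Fin m) (Fin n) ℝ) : ℝ :=
  ∑ i, ∑ j, ‖M i j‖ ^ 2

/-- Squared `j`-th tail energy: `τ_j(A)² = inf {‖A - B‖_F² : rank B < j}`. -/
noncomputable def tailEnergySq {m n : ℕ} (A : Matrix (Fin m) (Fin n) ℝ) (j : ℕ) : ℝ :=
  sInf {x : ℝ | ∃ B : Matrix (Fin m) (Fin n) ℝ, B.rank < j ∧ x = frobSq (A - B)}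

instance matrixMeasurableSpace {t s : ℕ} : MeasurableSpace (Matrix (Fin t) (Fin s) ℝ) :=
  MeasurableSpace.pi

/-- The law of a `t × s` real standard normal matrix: the entries are independent
standard Gaussians. -/
noncomputable def gaussMatrix (t s : ℕ) : Measure (Matrix (Fin t) (Fin s) ℝ) :=
  Measure.pi fun _ : Fin t => Measure.pi fun _ : Fin s => gaussianReal 0 1

/-- The law of a standard normal vector with coordinates indexed by `ι`. -/
noncomputable def gaussVec (ι : Type*) [Fintype ι] : Measure (ι → ℝ) :=
  Measure.pi fun _ : ι => gaussianReal 0 1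

instance {ι : Type*} [Fintype ι] : IsProbabilityMeasure (gaussVec ι) := by
  unfold gaussVec; infer_instance

instance {t s : ℕ} : IsProbabilityMeasure (gaussMatrix t s) :=
  inferInstanceAs (IsProbabilityMeasure (Measure.pi fun _ : Fin t => gaussVec (Fin s)))

theorem measurable_matrix_iff {α : Type*} [MeasurableSpace α] {t s : ℕ}
    {f : α → Matrix (Fin t) (Fin s) ℝ} : Measurable f ↔ ∀ i j, Measurable fun a => f a i j :=
  measurable_pi_iff.trans (forall_congr' fun _ => measurable_pi_iff)

theorem measurable_matrix_apply {α : Type*} [MeasurableSpace α] {t s : ℕ}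
    {f : α → Matrix (Fin t) (Fin s) ℝ} (hf : Measurable f) (i : Fin t) (j : Fin s) :
    Measurable fun a => f a i j :=
  measurable_matrix_iff.1 hf i j

theorem Measurable.matrix_mul {α : Type*} [MeasurableSpace α] {t s r : ℕ}
    {f : α → Matrix (Fin t) (Fin s) ℝ} {g : α → Matrix (Fin s) (Fin r) ℝ}
    (hf : Measurable f) (hg : Measurable g) : Measurable fun a => f a * g a := by
  refine measurable_matrix_iff.2 fun i j => ?_
  simp only [Matrix.mul_apply]
  exact Finset.measurable_sum _ fun l _ =>
    (measurable_matrix_apply hf i l).mul (measurable_matrix_apply hg l j)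

theorem Measurable.matrix_transpose {α : Type*} [MeasurableSpace α] {t s : ℕ}
    {f : α → Matrix (Fin t) (Fin s) ℝ} (hf : Measurable f) : Measurable fun a => (f a)ᵀ :=
  measurable_matrix_iff.2 fun i j => measurable_matrix_apply hf j i

theorem Measurable.matrix_det {α : Type*} [MeasurableSpace α] {s : ℕ}
    {f : α → Matrix (Fin s) (Fin s) ℝ} (hf : Measurable f) : Measurable fun a => (f a).det := by
  simp only [Matrix.det_apply]
  exact Finset.measurable_sum _ fun σ _ =>
    (Finset.measurable_prod _ fun i _ => measurable_matrix_apply hf _ _).const_smul _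

theorem Measurable.matrix_inv {α : Type*} [MeasurableSpace α] {s : ℕ}
    {f : α → Matrix (Fin s) (Fin s) ℝ} (hf : Measurable f) : Measurable fun a => (f a)⁻¹ := by
  refine measurable_matrix_iff.2 fun i j => ?_
  simp only [Matrix.inv_def, Matrix.smul_apply, Ring.inverse_eq_inv', smul_eq_mul,
    Matrix.adjugate_apply]
  refine hf.matrix_det.inv.mul (Measurable.matrix_det (measurable_matrix_iff.2 fun a b => ?_))
  simp only [Matrix.updateRow_apply]
  split_ifs
  · exact measurable_const
  · exact measurable_matrix_apply hf _ _

theorem Measurable.frobSq {α : Type*} [MeasurableSpace α] {t s : ℕ}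
    {f : α → Matrix (Fin t) (Fin s) ℝ} (hf : Measurable f) : Measurable fun a => frobSq (f a) :=
  Finset.measurable_sum _ fun i _ => Finset.measurable_sum _ fun j _ =>
    ((measurable_matrix_apply hf i j).norm).pow_const 2

/-- A standard normal vector times a matrix with orthonormal columns is standard normal. -/
theorem measurePreserving_vecMul_gaussVec {ι κ : Type*} [Fintype ι] [Fintype κ] [DecidableEq κ]
    (V : Matrix ι κ ℝ) (hV : Vᵀ * V = 1) :
    MeasurePreserving (fun x => x ᵥ* V) (gaussVec ι) (gaussVec κ) := by
  have hm : Measurable fun x : ι → ℝ => x ᵥ* V :=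
    (Continuous.matrix_vecMul continuous_id continuous_const).measurable
  have := Measure.isProbabilityMeasure_map (μ := gaussVec ι) hm.aemeasurable
  refine ⟨hm, charFun_eq_pi_iff.1 fun t => ?_⟩
  have key : charFun (((gaussVec ι).map fun x => x ᵥ* V).map (WithLp.toLp 2)) t
      = charFun ((gaussVec ι).map (WithLp.toLp 2)) (WithLp.toLp 2 (V *ᵥ t.ofLp)) := by
    rw [Measure.map_map (by fun_prop) hm]
    simp only [charFun]
    rw [integral_map (by fun_prop) (by fun_prop), integral_map (by fun_prop) (by fun_prop)]
    congr! 5 with x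
    simp only [PiLp.inner_apply, Function.comp, RCLike.inner_apply, conj_trivial]
    change t.ofLp ⬝ᵥ (x ᵥ* V) = (V *ᵥ t.ofLp) ⬝ᵥ x
    rw [dotProduct_comm, ← dotProduct_mulVec, dotProduct_comm]
  rw [key, gaussVec, charFun_pi]
  simp only [charFun_gaussianReal]
  rw [← Complex.exp_sum, ← Complex.exp_sum]
  have h2 : (V *ᵥ t.ofLp) ⬝ᵥ (V *ᵥ t.ofLp) = t.ofLp ⬝ᵥ t.ofLp := by
    rw [dotProduct_mulVec, vecMul_mulVec, ← dotProduct_mulVec, hV, one_mulVec]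
  simp only [dotProduct, ← pow_two] at h2
  congr 1
  simp only [Complex.ofReal_zero, mul_zero, zero_mul, zero_sub, Finset.sum_neg_distrib,
    NNReal.coe_one, Complex.ofReal_one, one_mul, ← Finset.sum_div]
  exact_mod_cast congrArg (fun r : ℝ => -((r : ℂ) / 2)) h2

theorem measurePreserving_mul_gaussMatrix {ℓ m d : ℕ} (V : Matrix (Fin m) (Fin d) ℝ)
    (hV : Vᵀ * V = 1) :
    MeasurePreserving (fun Ψ => Ψ * V) (gaussMatrix ℓ m) (gaussMatrix ℓ d) :=
  measurePreserving_pi _ _ fun _ => measurePreserving_vecMul_gaussVec V hV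

/-- Recombining two independent standard normal matrices along complementary projections gives a
standard normal matrix. -/
theorem measurePreserving_mul_add_mul_gaussMatrix {ℓ m : ℕ} (P R : Matrix (Fin m) (Fin m) ℝ)
    (hPR : Pᵀ * P + Rᵀ * R = 1) :
    MeasurePreserving (fun p : Matrix (Fin ℓ) (Fin m) ℝ × Matrix (Fin ℓ) (Fin m) ℝ =>
      p.1 * P + p.2 * R) ((gaussMatrix ℓ m).prod (gaussMatrix ℓ m)) (gaussMatrix ℓ m) := by
  have hrow : MeasurePreserving (fun p : (Fin m → ℝ) × (Fin m → ℝ) => p.1 ᵥ* P + p.2 ᵥ* R)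
      ((gaussVec (Fin m)).prod (gaussVec (Fin m))) (gaussVec (Fin m)) := by
    have h1 := measurePreserving_vecMul_gaussVec (fromRows P R)
      (by rw [transpose_fromRows, fromCols_mul_fromRows, hPR])
    have h2 := (measurePreserving_sumPiEquivProdPi_symm
      (fun _ : Fin m ⊕ Fin m => gaussianReal 0 1))
    have h3 : (fun p : (Fin m → ℝ) × (Fin m → ℝ) => p.1 ᵥ* P + p.2 ᵥ* R)
        = (fun x => x ᵥ* fromRows P R) ∘
          (MeasurableEquiv.sumPiEquivProdPi fun _ : Fin m ⊕ Fin m => ℝ).symm := by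
      ext p : 1
      exact (sumElim_vecMul_fromRows _ _ _ _).symm
    rw [h3]
    exact h1.comp h2
  have h3 := (measurePreserving_arrowProdEquivProdArrow (Fin m → ℝ) (Fin m → ℝ) (Fin ℓ)
    (fun _ => gaussVec (Fin m)) (fun _ => gaussVec (Fin m))).symm
  exact (measurePreserving_pi _ _ fun _ => hrow).comp h3

theorem measurePreserving_transpose_gaussMatrix (t s : ℕ) :
    MeasurePreserving (fun Ω => Ωᵀ) (gaussMatrix t s) (gaussMatrix s t) := by
  have h1 (a b : ℕ) : MeasurePreserving (MeasurableEquiv.curry (Fin a) (Fin b) ℝ)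
      (gaussVec (Fin a × Fin b)) (gaussMatrix a b) := by
    refine ⟨(MeasurableEquiv.curry _ _ _).measurable, ?_⟩
    have := Measure.infinitePi_map_curry (fun (_ : Fin a) (_ : Fin b) => gaussianReal 0 1)
    simp only [Measure.infinitePi_eq_pi] at this
    exact this
  have h2 := measurePreserving_piCongrLeft (fun _ => gaussianReal 0 1)
    (Equiv.prodComm (Fin t) (Fin s))
  exact ((h1 s t).comp h2).comp (h1 t s).symm

theorem memLp_integral_variance_sum_pi {ι : Type*} [Fintype ι] {α : ι → Type*}
    [∀ i, MeasurableSpace (α i)] {μ : ∀ i, Measure (α i)} [∀ i, IsProbabilityMeasure (μ i)]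
    {X : ∀ i, α i → ℝ} (hX : ∀ i, MemLp (X i) 2 (μ i)) (h0 : ∀ i, ∫ x, X i x ∂(μ i) = 0) :
    MemLp (fun ω => ∑ i, X i (ω i)) 2 (Measure.pi μ) ∧
      ∫ ω, ∑ i, X i (ω i) ∂(Measure.pi μ) = 0 ∧
      ∫ ω, (∑ i, X i (ω i)) ^ 2 ∂(Measure.pi μ) = ∑ i, ∫ x, X i x ^ 2 ∂(μ i) := by
  have hmem : ∀ i, MemLp (fun ω : ∀ i, α i => X i (ω i)) 2 (Measure.pi μ) := fun i =>
    (hX i).comp_measurePreserving (measurePreserving_eval μ i)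
  have hsum : MemLp (fun ω => ∑ i, X i (ω i)) 2 (Measure.pi μ) :=
    memLp_finsetSum _ fun i _ => hmem i
  have hint : ∫ ω, ∑ i, X i (ω i) ∂(Measure.pi μ) = 0 := by
    rw [integral_finsetSum _ fun i _ => (hmem i).integrable one_le_two]
    refine Finset.sum_eq_zero fun i _ => ?_
    rw [integral_comp_eval (hX i).aestronglyMeasurable, h0]
  refine ⟨hsum, hint, ?_⟩
  have hv := variance_sum_pi hX
  have he : (∑ i, fun ω : ∀ i, α i => X i (ω i)) = fun ω => ∑ i, X i (ω i) := by
    ext ω; simp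
  rw [he, variance_of_integral_eq_zero hsum.aemeasurable hint] at hv
  simpa only [variance_of_integral_eq_zero (hX _).aemeasurable (h0 _)] using hv

theorem memLp_integral_sq_dotProduct_gaussVec {ι : Type*} [Fintype ι] (c : ι → ℝ) :
    MemLp (fun x => ∑ j, x j * c j) 2 (gaussVec ι) ∧
      ∫ x, ∑ j, x j * c j ∂(gaussVec ι) = 0 ∧
      ∫ x, (∑ j, x j * c j) ^ 2 ∂(gaussVec ι) = ∑ j, c j ^ 2 := by
  have hid : MemLp (fun x : ℝ => x) 2 (gaussianReal 0 1) := memLp_id_gaussianReal' 2 (by simp)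
  have hsq : ∫ x : ℝ, x ^ 2 ∂(gaussianReal 0 1) = 1 := by
    have h := variance_fun_id_gaussianReal (μ := 0) (v := 1)
    rwa [variance_of_integral_eq_zero hid.aemeasurable integral_id_gaussianReal,
      NNReal.coe_one] at h
  have := memLp_integral_variance_sum_pi (μ := fun _ : ι => gaussianReal 0 1)
    (X := fun j x => x * c j) (fun j => hid.mul_const _)
    (fun j => by rw [integral_mul_const, integral_id_gaussianReal, zero_mul])
  simp only [mul_pow, integral_mul_const, hsq, one_mul] at this
  exact this

/-- Second moment of a bilinear image of a standard normal matrix. -/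
theorem lintegral_frobSq_mul_gaussMatrix_mul {ℓ m k n : ℕ} (M : Matrix (Fin k) (Fin ℓ) ℝ)
    (D : Matrix (Fin m) (Fin n) ℝ) :
    ∫⁻ Ψ, ENNReal.ofReal (frobSq (M * Ψ * D)) ∂(gaussMatrix ℓ m)
      = ENNReal.ofReal (frobSq M * frobSq D) := by
  have entry (a : Fin k) (b : Fin n) :
      Integrable (fun Ψ => (M * Ψ * D) a b ^ 2) (gaussMatrix ℓ m) ∧
      ∫ Ψ, (M * Ψ * D) a b ^ 2 ∂(gaussMatrix ℓ m)
        = (∑ i, M a i ^ 2) * ∑ j, D j b ^ 2 := by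
    obtain ⟨h1, h2, h3⟩ := memLp_integral_sq_dotProduct_gaussVec fun j => D j b
    obtain ⟨g1, -, g3⟩ := memLp_integral_variance_sum_pi
      (μ := fun _ : Fin ℓ => gaussVec (Fin m))
      (X := fun i x => M a i * ∑ j, x j * D j b) (fun i => h1.const_mul _)
      (fun i => by rw [integral_const_mul, h2, mul_zero])
    have he (Ψ : Matrix (Fin ℓ) (Fin m) ℝ) :
        (M * Ψ * D) a b = ∑ i, M a i * ∑ j, Ψ i j * D j b := by
      rw [Matrix.mul_assoc]; simp only [Matrix.mul_apply]
    simp only [he]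
    refine ⟨g1.integrable_sq, g3.trans ?_⟩
    simp only [mul_pow, integral_const_mul, h3, Finset.sum_mul]
  rw [← ofReal_integral_eq_lintegral_ofReal]
  · simp only [frobSq, Real.norm_eq_abs, sq_abs]
    rw [integral_finsetSum _ fun a _ => integrable_finsetSum _ fun b _ => (entry a b).1]
    simp only [integral_finsetSum _ fun b _ => (entry _ b).1, (entry _ _).2, ← Finset.mul_sum,
      ← Finset.sum_mul]
    rw [Finset.sum_comm (f := fun i j => D i j ^ 2)]
  · simp only [frobSq, Real.norm_eq_abs, sq_abs]
    exact integrable_finsetSum _ fun a _ => integrable_finsetSum _ fun b _ => (entry a b).1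
  · exact .of_forall fun Ψ => Finset.sum_nonneg fun a _ => Finset.sum_nonneg fun b _ => sq_nonneg _

theorem inv_ofReal_le_lintegral_exp {s : ℝ} (hs : 0 ≤ s) :
    (ENNReal.ofReal s)⁻¹
      ≤ ∫⁻ u in Set.Ioi (1 : ℝ), ENNReal.ofReal (1 / 2 * Real.exp (-((u - 1) / 2) * s)) := by
  rcases hs.eq_or_lt with rfl | hs
  · simp
  · have h : ∀ u : ℝ, 1 / 2 * Real.exp (-((u - 1) / 2) * s)
        = 1 / 2 * Real.exp (s / 2) * Real.exp (-(s / 2) * u) := fun u => by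
      rw [mul_assoc, ← Real.exp_add]; ring_nf
    simp only [h]
    rw [← ofReal_integral_eq_lintegral_ofReal
      ((integrableOn_exp_mul_Ioi (by linarith) 1).const_mul _)
      (.of_forall fun u => by positivity), integral_const_mul,
      integral_exp_mul_Ioi (by linarith) 1, ← ENNReal.ofReal_inv_of_pos hs]
    refine ENNReal.ofReal_le_ofReal (le_of_eq ?_)
    rw [mul_one, Real.exp_neg]
    field_simp [(Real.exp_pos (s/2)).ne']

theorem integrable_exp_mul_sq_gaussianReal {u : ℝ} (hu : 1 ≤ u) :
    Integrable (fun x => Real.exp (-((u - 1) / 2) * x ^ 2)) (gaussianReal 0 1) := by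
  refine Integrable.of_bound (by fun_prop) 1 (.of_forall fun x => ?_)
  rw [Real.norm_eq_abs, Real.abs_exp, Real.exp_le_one_iff, neg_mul, neg_nonpos]
  have : 0 ≤ u - 1 := by linarith
  positivity

theorem integral_exp_mul_sq_gaussianReal {u : ℝ} (hu : 0 < u) :
    ∫ x, Real.exp (-((u - 1) / 2) * x ^ 2) ∂(gaussianReal 0 1) = u ^ (-(1 / 2) : ℝ) := by
  rw [integral_gaussianReal_eq_integral_smul one_ne_zero]
  have h (x : ℝ) : gaussianPDFReal 0 1 x • Real.exp (-((u - 1) / 2) * x ^ 2)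
      = (√(2 * Real.pi))⁻¹ * Real.exp (-(u / 2) * x ^ 2) := by
    rw [gaussianPDFReal_def, smul_eq_mul, NNReal.coe_one, mul_one, mul_assoc, ← Real.exp_add]
    ring_nf
  simp only [h]
  rw [integral_const_mul, integral_gaussian, ← Real.sqrt_inv, ← Real.sqrt_mul (by positivity),
    Real.rpow_neg hu.le, ← Real.sqrt_eq_rpow, ← Real.sqrt_inv]
  congr 1
  field_simp

/-- The mean of the inverse of a chi-squared variable with `d ≥ 3` degrees of freedom. -/
theorem lintegral_inv_sum_sq_gaussVec_le {ι : Type*} [Fintype ι] (hι : 2 < Fintype.card ι) :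
    ∫⁻ x, (ENNReal.ofReal (∑ i, x i ^ 2))⁻¹ ∂(gaussVec ι)
      ≤ ENNReal.ofReal (1 / ((Fintype.card ι : ℝ) - 2)) := by
  have hmeas : Measurable fun p : (ι → ℝ) × ℝ =>
      ENNReal.ofReal (1 / 2 * Real.exp (-((p.2 - 1) / 2) * ∑ i, p.1 i ^ 2)) := by fun_prop
  have hd : (2 : ℝ) < Fintype.card ι := by exact_mod_cast hι
  calc _ ≤ ∫⁻ x : ι → ℝ, ∫⁻ u in Set.Ioi (1 : ℝ),
        ENNReal.ofReal (1 / 2 * Real.exp (-((u - 1) / 2) * ∑ i, x i ^ 2)) ∂volume ∂(gaussVec ι) :=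
        lintegral_mono fun x => inv_ofReal_le_lintegral_exp
          (Finset.sum_nonneg fun i _ => sq_nonneg _)
    _ = ∫⁻ u in Set.Ioi (1 : ℝ), ∫⁻ x : ι → ℝ,
        ENNReal.ofReal (1 / 2 * Real.exp (-((u - 1) / 2) * ∑ i, x i ^ 2)) ∂(gaussVec ι) ∂volume :=
        lintegral_lintegral_swap hmeas.aemeasurable
    _ = ∫⁻ u in Set.Ioi (1 : ℝ), ENNReal.ofReal (1 / 2 * u ^ (-(Fintype.card ι / 2) : ℝ)) := by
        refine setLIntegral_congr_fun measurableSet_Ioi fun u hu => ?_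
        have hu0 : 0 < u := lt_trans one_pos hu
        simp only [Finset.mul_sum, Real.exp_sum]
        simp only [ENNReal.ofReal_mul (show (0 : ℝ) ≤ 1 / 2 by norm_num)]
        rw [lintegral_const_mul _ (by fun_prop)]
        congr 1
        rw [gaussVec, ← ofReal_integral_eq_lintegral_ofReal
          (Integrable.fintype_prod fun _ => integrable_exp_mul_sq_gaussianReal (le_of_lt hu))
          (.of_forall fun x => Finset.prod_nonneg fun i _ => (Real.exp_pos _).le),
          integral_fintype_prod_eq_prod (𝕜 := ℝ)
            (fun (_ : ι) (x : ℝ) => Real.exp (-((u - 1) / 2) * x ^ 2)),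
          integral_exp_mul_sq_gaussianReal hu0, Finset.prod_const, Finset.card_univ,
          ← Real.rpow_natCast, ← Real.rpow_mul hu0.le]
        congr 2
        ring
    _ = _ := by
        rw [← ofReal_integral_eq_lintegral_ofReal
          ((integrableOn_Ioi_rpow_of_lt (by linarith) one_pos).const_mul _)
          ((ae_restrict_iff' measurableSet_Ioi).2 (.of_forall fun u hu => by
            have : 0 < u := lt_trans one_pos hu
            positivity)), integral_const_mul,
          integral_Ioi_rpow_of_lt (by linarith) one_pos, Real.one_rpow]
        congr 1
        have : (-(Fintype.card ι / 2) + 1 : ℝ) = -((Fintype.card ι - 2) / 2) := by ring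
        rw [this]
        field_simp [(show (Fintype.card ι : ℝ) - 2 ≠ 0 by linarith)]

theorem frobSq_eq_trace {m n : ℕ} (M : Matrix (Fin m) (Fin n) ℝ) :
    frobSq M = (Mᵀ * M).trace := by
  simp only [frobSq, Matrix.trace, Matrix.diag, Matrix.mul_apply, Matrix.transpose_apply,
    Real.norm_eq_abs, pow_two, abs_mul_abs_self]
  exact Finset.sum_comm

theorem frobSq_nonneg {m n : ℕ} (M : Matrix (Fin m) (Fin n) ℝ) : 0 ≤ frobSq M :=
  Finset.sum_nonneg fun _ _ => Finset.sum_nonneg fun _ _ => sq_nonneg _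

theorem frobSq_transpose {m n : ℕ} (M : Matrix (Fin m) (Fin n) ℝ) : frobSq Mᵀ = frobSq M :=
  Finset.sum_comm

theorem frobSq_neg {m n : ℕ} (M : Matrix (Fin m) (Fin n) ℝ) : frobSq (-M) = frobSq M := by
  simp [frobSq]

theorem frobSq_add_of_transpose_mul_eq_zero {m n : ℕ} {M N : Matrix (Fin m) (Fin n) ℝ}
    (h : Mᵀ * N = 0) : frobSq (M + N) = frobSq M + frobSq N := by
  have h' : Nᵀ * M = 0 := by simpa using congrArg Matrix.transpose h
  simp only [frobSq_eq_trace, transpose_add, Matrix.add_mul, Matrix.mul_add, h, h', trace_add,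
    add_zero, zero_add]

theorem frobSq_mul_of_orthonormal {m k n : ℕ} {Q : Matrix (Fin m) (Fin k) ℝ} (hQ : Qᵀ * Q = 1)
    (M : Matrix (Fin k) (Fin n) ℝ) : frobSq (Q * M) = frobSq M := by
  rw [frobSq_eq_trace, frobSq_eq_trace, transpose_mul, Matrix.mul_assoc, ← Matrix.mul_assoc Qᵀ,
    hQ, Matrix.one_mul]

/-- Among all left inverses the pseudoinverse has the smallest Frobenius norm. -/
theorem isUnit_det_and_frobSq_pinv_le {ℓ k : ℕ} {G : Matrix (Fin ℓ) (Fin k) ℝ}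
    {W : Matrix (Fin k) (Fin ℓ) ℝ} (hW : W * G = 1) :
    IsUnit (Gᵀ * G).det ∧ frobSq ((Gᵀ * G)⁻¹ * Gᵀ) ≤ frobSq W := by
  have hu : IsUnit (Gᵀ * G) := by
    rw [← Matrix.mulVec_injective_iff_isUnit]
    refine (injective_iff_map_eq_zero (Gᵀ * G).mulVecLin).2 fun v hv => ?_
    have h1 : G *ᵥ v = 0 := by
      have := (conjTranspose_mul_self_mulVec_eq_zero G v).1
      rw [conjTranspose_eq_transpose_of_trivial] at this
      exact this hv
    rw [← Matrix.one_mulVec v, ← hW, ← Matrix.mulVec_mulVec, h1, mulVec_zero]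
  have hd := (Matrix.isUnit_iff_isUnit_det _).1 hu
  refine ⟨hd, ?_⟩
  set S := (Gᵀ * G)⁻¹ * Gᵀ with hS
  have hSG : S * G = 1 := by rw [hS, Matrix.mul_assoc, nonsing_inv_mul _ hd]
  have h0 : (W - S) * G = 0 := by rw [Matrix.sub_mul, hW, hSG, sub_self]
  have horth : Sᵀᵀ * (W - S)ᵀ = 0 := by
    rw [transpose_transpose, hS, Matrix.mul_assoc, ← hS, ← transpose_mul, h0, transpose_zero,
      Matrix.mul_zero]
  have := frobSq_add_of_transpose_mul_eq_zero horth
  rw [← transpose_add, add_sub_cancel, frobSq_transpose, frobSq_transpose, frobSq_transpose] at this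
  rw [this]
  exact le_add_of_nonneg_right (frobSq_nonneg _)

/-- Squared distance of `x` to the span of the vectors `g j`. -/
noncomputable def distSqSpan {ι κ : Type*} [Fintype ι] [Fintype κ] (g : κ → ι → ℝ) (x : ι → ℝ) :
    ENNReal :=
  ⨅ c : κ → ℝ, ENNReal.ofReal (∑ i, (x i - ∑ j, c j * g j i) ^ 2)

theorem measurable_distSqSpan {ι κ : Type*} [Fintype ι] [Fintype κ] :
    Measurable fun p : (ι → ℝ) × (κ → ι → ℝ) => distSqSpan p.2 p.1 := by
  refine UpperSemicontinuous.measurable (upperSemicontinuous_iInf fun c => ?_)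
  exact (ENNReal.continuous_ofReal.comp (by fun_prop)).upperSemicontinuous

theorem exists_orthonormal_annihilating {ι κ : Type*} [Fintype ι] [Fintype κ]
    (g : κ → ι → ℝ) : ∃ (d : ℕ) (V : Matrix ι (Fin d) ℝ), Vᵀ * V = 1 ∧
      (∀ j, g j ᵥ* V = 0) ∧ Fintype.card ι ≤ d + Fintype.card κ := by
  classical
  let K : Submodule ℝ (EuclideanSpace ℝ ι) :=
    Submodule.span ℝ (Set.range fun j => WithLp.toLp 2 (g j))
  let b := stdOrthonormalBasis ℝ Kᗮ
  have hin (v w : EuclideanSpace ℝ ι) : ∑ i, v i * w i = inner ℝ v w := by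
    simp [PiLp.inner_apply, mul_comm]
  refine ⟨_, Matrix.of fun i a => (b a : EuclideanSpace ℝ ι) i, ?_, fun j => ?_, ?_⟩
  · ext a a'
    rw [Matrix.mul_apply]
    simp only [transpose_apply, of_apply]
    rw [hin, ← Submodule.coe_inner, orthonormal_iff_ite.1 b.orthonormal, Matrix.one_apply]
  · ext a
    simp only [vecMul, dotProduct, of_apply, Pi.zero_apply]
    exact (hin (WithLp.toLp 2 (g j)) _).trans
      ((b a).2 _ (Submodule.subset_span ⟨j, rfl⟩))
  · have h1 := K.finrank_add_finrank_orthogonal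
    have h2 : Module.finrank ℝ K ≤ Fintype.card κ := finrank_range_le_card _
    rw [finrank_euclideanSpace] at h1
    omega

theorem lintegral_inv_distSqSpan_gaussVec_le {ι κ : Type*} [Fintype ι] [Fintype κ]
    (g : κ → ι → ℝ) (hcard : Fintype.card κ + 2 < Fintype.card ι) :
    ∫⁻ x, (distSqSpan g x)⁻¹ ∂(gaussVec ι)
      ≤ ENNReal.ofReal (1 / ((Fintype.card ι : ℝ) - Fintype.card κ - 2)) := by
  obtain ⟨d, V, hV, hgV, hd⟩ := exists_orthonormal_annihilating g
  have hle (x : ι → ℝ) : ENNReal.ofReal (∑ a, (x ᵥ* V) a ^ 2) ≤ distSqSpan g x := by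
    refine le_iInf fun c => ENNReal.ofReal_le_ofReal ?_
    set y : ι → ℝ := fun i => x i - ∑ j, c j * g j i with hy
    have hxy : x ᵥ* V = y ᵥ* V := by
      have : y = x - ∑ j, c j • g j := by ext i; simp [hy]
      rw [this, sub_vecMul, sum_vecMul]
      simp [smul_vecMul, hgV]
    rw [hxy]
    set z := y ᵥ* V with hz
    have h1 : (V *ᵥ z) ⬝ᵥ (V *ᵥ z) = z ⬝ᵥ z := by
      rw [dotProduct_mulVec, vecMul_mulVec, ← dotProduct_mulVec, hV, one_mulVec]
    have h2 : y ⬝ᵥ (V *ᵥ z) = z ⬝ᵥ z := by rw [dotProduct_mulVec]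
    have h3 : 0 ≤ (y - V *ᵥ z) ⬝ᵥ (y - V *ᵥ z) :=
      Finset.sum_nonneg fun i _ => mul_self_nonneg _
    rw [sub_dotProduct, dotProduct_sub, dotProduct_sub, dotProduct_comm (V *ᵥ z) y, h1, h2] at h3
    have h4 : z ⬝ᵥ z ≤ y ⬝ᵥ y := by linarith
    simpa only [dotProduct, ← pow_two] using h4
  have hd2 : 2 < d := by omega
  calc _ ≤ ∫⁻ x, (ENNReal.ofReal (∑ a, (x ᵥ* V) a ^ 2))⁻¹ ∂(gaussVec ι) :=
        lintegral_mono fun x => ENNReal.inv_le_inv.2 (hle x)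
    _ = ∫⁻ z, (ENNReal.ofReal (∑ a, z a ^ 2))⁻¹ ∂(gaussVec (Fin d)) :=
        (measurePreserving_vecMul_gaussVec V hV).lintegral_comp
          (f := fun z => (ENNReal.ofReal (∑ a, z a ^ 2))⁻¹) (by fun_prop)
    _ ≤ _ := lintegral_inv_sum_sq_gaussVec_le (by simpa using hd2)
    _ ≤ _ := by
        have h1 : (Fintype.card ι : ℝ) ≤ d + Fintype.card κ := by exact_mod_cast hd
        have h2 : (Fintype.card κ : ℝ) + 2 < Fintype.card ι := by exact_mod_cast hcard
        refine ENNReal.ofReal_le_ofReal (one_div_le_one_div_of_le (by linarith) ?_)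
        rw [Fintype.card_fin]
        linarith

theorem exists_dual_vector_of_distSqSpan_ne_zero {ι κ : Type*} [Fintype ι] [Fintype κ]
    {g : κ → ι → ℝ} {x : ι → ℝ} (h : distSqSpan g x ≠ 0) :
    ∃ w : ι → ℝ, w ⬝ᵥ x = 1 ∧ (∀ j, w ⬝ᵥ g j = 0) ∧
      ENNReal.ofReal (w ⬝ᵥ w) ≤ (distSqSpan g x)⁻¹ := by
  let K : Submodule ℝ (EuclideanSpace ℝ ι) :=
    Submodule.span ℝ (Set.range fun j => WithLp.toLp 2 (g j))
  obtain ⟨c, hc⟩ := (Submodule.mem_span_range_iff_exists_fun ℝ).1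
    (K.starProjection_apply_mem (WithLp.toLp 2 x))
  have hin (v w : EuclideanSpace ℝ ι) : v.ofLp ⬝ᵥ w.ofLp = inner ℝ v w := by
    simp [PiLp.inner_apply, dotProduct, mul_comm]
  have hperp := K.sub_starProjection_mem_orthogonal (WithLp.toLp 2 x)
  rw [← hc] at hperp
  set r : ι → ℝ := fun i => x i - ∑ j, c j * g j i with hr
  have hr' : r = x - ∑ j, c j • g j := by ext i; simp [hr]
  have hrg (j : κ) : r ⬝ᵥ g j = 0 := by
    have := hperp _ (Submodule.subset_span ⟨j, rfl⟩)
    rw [← hin, dotProduct_comm] at this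
    simpa [hr'] using this
  have hrx : r ⬝ᵥ x = r ⬝ᵥ r := by
    have hx : x = r + ∑ j, c j • g j := by rw [hr', sub_add_cancel]
    have h0 : r ⬝ᵥ ∑ j, c j • g j = 0 := by
      rw [dotProduct_sum]
      exact Finset.sum_eq_zero fun j _ => by rw [dotProduct_smul, hrg, smul_zero]
    conv_lhs => rw [hx]
    rw [dotProduct_add, h0, add_zero]
  have hdist : distSqSpan g x ≤ ENNReal.ofReal (r ⬝ᵥ r) :=
    (iInf_le _ c).trans_eq (by simp only [dotProduct, ← pow_two, hr])
  have hpos : 0 < r ⬝ᵥ r := ENNReal.ofReal_pos.1 ((pos_iff_ne_zero.2 h).trans_le hdist)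
  refine ⟨(r ⬝ᵥ r)⁻¹ • r, ?_, fun j => ?_, ?_⟩
  · rw [smul_dotProduct, hrx, smul_eq_mul, inv_mul_cancel₀ hpos.ne']
  · rw [smul_dotProduct, hrg, smul_zero]
  · rw [smul_dotProduct, dotProduct_smul, smul_eq_mul, smul_eq_mul, inv_mul_cancel₀ hpos.ne',
      mul_one, ENNReal.ofReal_inv_of_pos hpos]
    exact ENNReal.inv_le_inv.2 hdist

theorem measurable_distSqSpan_succAbove {ℓ k : ℕ} (j : Fin (k + 1)) :
    Measurable fun H : Matrix (Fin (k + 1)) (Fin ℓ) ℝ =>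
      distSqSpan (fun i => H (j.succAbove i)) (H j) := by
  have hf : Measurable fun H : Fin (k + 1) → Fin ℓ → ℝ =>
      (H j, fun i : Fin k => H (j.succAbove i)) :=
    (measurable_pi_apply j).prodMk (measurable_pi_lambda _ fun i => measurable_pi_apply _)
  have h := (measurable_distSqSpan (ι := Fin ℓ) (κ := Fin k)).comp hf
  simp only [Function.comp_def] at h
  exact h

theorem lintegral_inv_distSqSpan_gaussMatrix_le {ℓ k : ℕ} (h : k + 2 < ℓ) (j : Fin (k + 1)) :
    ∫⁻ H, (distSqSpan (fun i => H (j.succAbove i)) (H j))⁻¹ ∂(gaussMatrix (k + 1) ℓ)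
      ≤ ENNReal.ofReal (1 / ((ℓ : ℝ) - k - 2)) := by
  have hm : Measurable fun p : (Fin ℓ → ℝ) × (Fin k → Fin ℓ → ℝ) => (distSqSpan p.2 p.1)⁻¹ :=
    measurable_distSqSpan.inv
  calc _ = ∫⁻ p, (distSqSpan p.2 p.1)⁻¹ ∂((gaussVec (Fin ℓ)).prod
          (Measure.pi fun _ : Fin k => gaussVec (Fin ℓ))) :=
        (measurePreserving_piFinSuccAbove (fun _ => gaussVec (Fin ℓ)) j).lintegral_comp hm
    _ = ∫⁻ g, ∫⁻ x, (distSqSpan g x)⁻¹ ∂(gaussVec (Fin ℓ))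
          ∂(Measure.pi fun _ : Fin k => gaussVec (Fin ℓ)) := lintegral_prod_symm' _ hm
    _ ≤ ∫⁻ _, ENNReal.ofReal (1 / ((ℓ : ℝ) - k - 2))
          ∂(Measure.pi fun _ : Fin k => gaussVec (Fin ℓ)) := lintegral_mono fun g => by
        simpa using lintegral_inv_distSqSpan_gaussVec_le g (by simpa using h)
    _ = _ := by simp

theorem exists_leftInverse_of_distSqSpan_ne_zero {ℓ k : ℕ} {H : Matrix (Fin (k + 1)) (Fin ℓ) ℝ}
    (h : ∀ j : Fin (k + 1), distSqSpan (fun i => H (j.succAbove i)) (H j) ≠ 0) :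
    ∃ W : Matrix (Fin (k + 1)) (Fin ℓ) ℝ, W * Hᵀ = 1 ∧ ENNReal.ofReal (frobSq W)
      ≤ ∑ j : Fin (k + 1), (distSqSpan (fun i => H (j.succAbove i)) (H j))⁻¹ := by
  choose w h1 h2 h3 using fun j => exists_dual_vector_of_distSqSpan_ne_zero (h j)
  refine ⟨Matrix.of w, ?_, ?_⟩
  · ext a b
    rw [Matrix.mul_apply, Matrix.one_apply]
    change w a ⬝ᵥ H b = _
    split_ifs with hab
    · rw [← hab, h1]
    · obtain ⟨i, rfl⟩ := Fin.exists_succAbove_eq (Ne.symm hab)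
      exact h2 a i
  · have : frobSq (Matrix.of w) = ∑ j, w j ⬝ᵥ w j := by
      simp [frobSq, dotProduct, pow_two]
    have hs : ENNReal.ofReal (∑ j, w j ⬝ᵥ w j) = ∑ j, ENNReal.ofReal (w j ⬝ᵥ w j) :=
      ENNReal.ofReal_sum_of_nonneg fun j _ => Finset.sum_nonneg fun i _ => mul_self_nonneg _
    rw [this, hs]
    exact Finset.sum_le_sum fun j _ => h3 j

/-- A tall standard normal matrix almost surely has full column rank, and the squared Frobenius
norm of its pseudoinverse has mean at most `k / (ℓ - k - 1)`. -/
theorem ae_isUnit_and_lintegral_frobSq_pinv_gaussMatrix_le {ℓ k : ℕ} (h : k + 1 < ℓ) :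
    (∀ᵐ G ∂(gaussMatrix ℓ k), IsUnit (Gᵀ * G).det) ∧
      ∫⁻ G, ENNReal.ofReal (frobSq ((Gᵀ * G)⁻¹ * Gᵀ)) ∂(gaussMatrix ℓ k)
        ≤ ENNReal.ofReal ((k : ℝ) / ((ℓ : ℝ) - k - 1)) := by
  cases k with
  | zero => simp [frobSq]
  | succ k =>
    let f : Matrix (Fin (k + 1)) (Fin ℓ) ℝ → ENNReal := fun H =>
      ∑ j : Fin (k + 1), (distSqSpan (fun i => H (j.succAbove i)) (H j))⁻¹
    have hfm : Measurable f :=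
      Finset.measurable_sum _ fun j _ => (measurable_distSqSpan_succAbove j).inv
    have hint : ∫⁻ G, f Gᵀ ∂(gaussMatrix ℓ (k + 1))
        ≤ ENNReal.ofReal (((k + 1 : ℕ) : ℝ) / ((ℓ : ℝ) - (k + 1 : ℕ) - 1)) := by
      have hsum : ∫⁻ H, f H ∂(gaussMatrix (k + 1) ℓ) = ∑ j : Fin (k + 1),
          ∫⁻ H, (distSqSpan (fun i => H (j.succAbove i)) (H j))⁻¹ ∂(gaussMatrix (k + 1) ℓ) :=
        lintegral_finsetSum _ fun j _ => (measurable_distSqSpan_succAbove j).inv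
      rw [(measurePreserving_transpose_gaussMatrix ℓ (k + 1)).lintegral_comp hfm, hsum]
      refine (Finset.sum_le_sum fun j _ =>
        lintegral_inv_distSqSpan_gaussMatrix_le (by omega) j).trans_eq ?_
      rw [Finset.sum_const, Finset.card_univ, Fintype.card_fin, ← ENNReal.ofReal_nsmul]
      congr 1
      rw [nsmul_eq_mul]
      push_cast
      ring
    have hae : ∀ᵐ G ∂(gaussMatrix ℓ (k + 1)), f Gᵀ < ⊤ :=
      ae_lt_top (hfm.comp (measurePreserving_transpose_gaussMatrix ℓ (k + 1)).measurable)
        (hint.trans_lt ENNReal.ofReal_lt_top).ne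
    have hkey : ∀ᵐ G ∂(gaussMatrix ℓ (k + 1)), IsUnit (Gᵀ * G).det ∧
        ENNReal.ofReal (frobSq ((Gᵀ * G)⁻¹ * Gᵀ)) ≤ f Gᵀ := by
      filter_upwards [hae] with G hG
      obtain ⟨W, hW, hWf⟩ := exists_leftInverse_of_distSqSpan_ne_zero (H := Gᵀ) fun j hj => by
        have := (ENNReal.sum_lt_top.1 hG) j (Finset.mem_univ _)
        rw [hj, ENNReal.inv_zero] at this
        exact this.ne rfl
      obtain ⟨h1, h2⟩ := isUnit_det_and_frobSq_pinv_le hW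
      exact ⟨h1, (ENNReal.ofReal_le_ofReal h2).trans hWf⟩
    exact ⟨hkey.mono fun _ h => h.1, (lintegral_mono_ae (hkey.mono fun _ h => h.2)).trans hint⟩

/-- With `P = QQᵀ` the sketched projection error splits orthogonally. -/
theorem frobSq_sub_sketch_eq {m n k ℓ : ℕ} (A : Matrix (Fin m) (Fin n) ℝ)
    {Q : Matrix (Fin m) (Fin k) ℝ} (hQ : Qᵀ * Q = 1) {Ψ : Matrix (Fin ℓ) (Fin m) ℝ}
    (hu : IsUnit ((Ψ * Q)ᵀ * (Ψ * Q)).det) :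
    frobSq (A - Q * (((Ψ * Q)ᵀ * (Ψ * Q))⁻¹ * (Ψ * Q)ᵀ * (Ψ * A)))
      = frobSq (A - Q * (Qᵀ * A)) + frobSq (((Ψ * Q)ᵀ * (Ψ * Q))⁻¹ * (Ψ * Q)ᵀ * Ψ *
        (A - Q * (Qᵀ * A))) := by
  set S := ((Ψ * Q)ᵀ * (Ψ * Q))⁻¹ * (Ψ * Q)ᵀ with hS
  have hSQ : S * (Ψ * Q) = 1 := by rw [hS, Matrix.mul_assoc, nonsing_inv_mul _ hu]
  set D := A - Q * (Qᵀ * A) with hD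
  have hQD : Qᵀ * D = 0 := by
    rw [hD, Matrix.mul_sub, ← Matrix.mul_assoc, hQ, Matrix.one_mul, sub_self]
  have hA : A = Q * (Qᵀ * A) + D := by rw [hD]; abel
  have hSA : S * (Ψ * A) = Qᵀ * A + S * Ψ * D := by
    conv_lhs => rw [hA]
    rw [Matrix.mul_add, Matrix.mul_add, ← Matrix.mul_assoc Ψ, ← Matrix.mul_assoc S, hSQ,
      Matrix.one_mul, Matrix.mul_assoc S]
  have hsplit : A - Q * (S * (Ψ * A)) = D + -(Q * (S * Ψ * D)) := by
    rw [hSA, Matrix.mul_add, hD]; abel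
  have horth : Dᵀ * -(Q * (S * Ψ * D)) = 0 := by
    have : Dᵀ * Q = 0 := by simpa using congrArg Matrix.transpose hQD
    rw [Matrix.mul_neg, ← Matrix.mul_assoc, this, Matrix.zero_mul, neg_zero]
  rw [hsplit, frobSq_add_of_transpose_mul_eq_zero horth, frobSq_neg, frobSq_mul_of_orthonormal hQ]

/-- Mean error of a Gaussian sketched projection onto a fixed subspace. -/
theorem lintegral_frobSq_sub_sketch_le {m n k ℓ : ℕ} (h : k + 1 < ℓ)
    (A : Matrix (Fin m) (Fin n) ℝ) {Q : Matrix (Fin m) (Fin k) ℝ} (hQ : Qᵀ * Q = 1) :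
    ∫⁻ Ψ, ENNReal.ofReal (frobSq (A - Q * (((Ψ * Q)ᵀ * (Ψ * Q))⁻¹ * (Ψ * Q)ᵀ * (Ψ * A))))
        ∂(gaussMatrix ℓ m)
      ≤ ENNReal.ofReal ((1 + (k : ℝ) / ((ℓ : ℝ) - k - 1)) * frobSq (A - Q * (Qᵀ * A))) := by
  have hℓ : (0 : ℝ) < (ℓ : ℝ) - k - 1 := by
    have : ((k + 1 : ℕ) : ℝ) < ℓ := by exact_mod_cast h
    push_cast at this
    linarith
  obtain ⟨hunit, hpinv⟩ := ae_isUnit_and_lintegral_frobSq_pinv_gaussMatrix_le h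
  have hmp := measurePreserving_mul_gaussMatrix (ℓ := ℓ) Q hQ
  set D := A - Q * (Qᵀ * A) with hD
  set P := Q * Qᵀ with hP
  have hPt : Pᵀ = P := by rw [hP, transpose_mul, transpose_transpose]
  have hPQ : P * Q = Q := by rw [hP, Matrix.mul_assoc, hQ, Matrix.mul_one]
  have hPP : P * P = P := by rw [hP, Matrix.mul_assoc, ← Matrix.mul_assoc Qᵀ, hQ, Matrix.one_mul]
  have hPD : P * D = 0 := by
    rw [hD, Matrix.mul_sub, ← Matrix.mul_assoc, ← Matrix.mul_assoc, hPQ, hP, Matrix.mul_assoc,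
      sub_self]
  have hmix := measurePreserving_mul_add_mul_gaussMatrix (ℓ := ℓ) P (1 - P) (by
    rw [transpose_sub, transpose_one, hPt, hPP, Matrix.mul_sub, Matrix.mul_one, Matrix.sub_mul,
      Matrix.one_mul, hPP, sub_self, sub_zero, add_sub_cancel])
  let T : Matrix (Fin ℓ) (Fin k) ℝ → Matrix (Fin k) (Fin ℓ) ℝ := fun G => (Gᵀ * G)⁻¹ * Gᵀ
  have hT : Measurable T :=
    (measurable_id.matrix_transpose.matrix_mul measurable_id).matrix_inv.matrix_mul
      measurable_id.matrix_transpose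
  have hmul (V : Matrix (Fin m) (Fin k) ℝ) :
      Measurable fun Ψ : Matrix (Fin ℓ) (Fin m) ℝ => Ψ * V :=
    measurable_id.matrix_mul measurable_const
  have hF : Measurable fun Ψ : Matrix (Fin ℓ) (Fin m) ℝ =>
      ENNReal.ofReal (frobSq (T (Ψ * Q) * Ψ * D)) :=
    ((((hT.comp (hmul Q)).matrix_mul measurable_id).matrix_mul
      measurable_const).frobSq).ennreal_ofReal
  have hsecond : ∫⁻ Ψ, ENNReal.ofReal (frobSq (T (Ψ * Q) * Ψ * D)) ∂(gaussMatrix ℓ m)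
      ≤ ENNReal.ofReal ((k : ℝ) / ((ℓ : ℝ) - k - 1)) * ENNReal.ofReal (frobSq D) := by
    rw [← hmix.lintegral_comp hF,
      lintegral_prod (fun p : Matrix (Fin ℓ) (Fin m) ℝ × Matrix (Fin ℓ) (Fin m) ℝ =>
        ENNReal.ofReal (frobSq (T ((p.1 * P + p.2 * (1 - P)) * Q) *
          (p.1 * P + p.2 * (1 - P)) * D))) (hF.comp hmix.measurable).aemeasurable]
    have hred (Ψ Ψ' : Matrix (Fin ℓ) (Fin m) ℝ) :
        T ((Ψ * P + Ψ' * (1 - P)) * Q) * (Ψ * P + Ψ' * (1 - P)) * D = T (Ψ * Q) * Ψ' * D := by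
      have h1 : (Ψ * P + Ψ' * (1 - P)) * Q = Ψ * Q := by
        rw [Matrix.add_mul, Matrix.mul_assoc Ψ, Matrix.mul_assoc Ψ', Matrix.sub_mul, hPQ,
          Matrix.one_mul, sub_self, Matrix.mul_zero, add_zero]
      have h2 : (Ψ * P + Ψ' * (1 - P)) * D = Ψ' * D := by
        rw [Matrix.add_mul, Matrix.mul_assoc Ψ, Matrix.mul_assoc Ψ', Matrix.sub_mul, hPD,
          Matrix.one_mul, Matrix.mul_zero, sub_zero, zero_add]
      rw [Matrix.mul_assoc (T _), h1, h2, Matrix.mul_assoc (T _)]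
    simp only [hred, lintegral_frobSq_mul_gaussMatrix_mul, ENNReal.ofReal_mul (frobSq_nonneg _)]
    have hTQ : Measurable fun Ψ : Matrix (Fin ℓ) (Fin m) ℝ =>
        ENNReal.ofReal (frobSq (T (Ψ * Q))) := (hT.comp (hmul Q)).frobSq.ennreal_ofReal
    rw [lintegral_mul_const _ hTQ,
      hmp.lintegral_comp (f := fun G => ENNReal.ofReal (frobSq (T G))) hT.frobSq.ennreal_ofReal]
    gcongr
  have hunit' : ∀ᵐ Ψ ∂(gaussMatrix ℓ m), IsUnit ((Ψ * Q)ᵀ * (Ψ * Q)).det :=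
    hmp.quasiMeasurePreserving.ae hunit
  calc _ = ∫⁻ Ψ, (ENNReal.ofReal (frobSq D) + ENNReal.ofReal (frobSq (T (Ψ * Q) * Ψ * D)))
          ∂(gaussMatrix ℓ m) := lintegral_congr_ae <| hunit'.mono fun Ψ hΨ => by
        simp only [frobSq_sub_sketch_eq A hQ hΨ]
        exact ENNReal.ofReal_add (frobSq_nonneg _) (frobSq_nonneg _)
    _ = ENNReal.ofReal (frobSq D) + ∫⁻ Ψ, ENNReal.ofReal (frobSq (T (Ψ * Q) * Ψ * D))
          ∂(gaussMatrix ℓ m) := by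
        rw [lintegral_add_left measurable_const, lintegral_const, measure_univ, mul_one]
    _ ≤ _ := add_le_add_right hsecond _
    _ = _ := by
        rw [add_mul, one_mul, ENNReal.ofReal_add (frobSq_nonneg _)
          (mul_nonneg (by positivity) (frobSq_nonneg _)), ENNReal.ofReal_mul (by positivity)]

/-- The orthogonal projection onto the range of `Q` gives the best approximation with columns in
that range. -/
theorem frobSq_sub_proj_le {m n k : ℕ} (A : Matrix (Fin m) (Fin n) ℝ)
    {Q : Matrix (Fin m) (Fin k) ℝ} (hQ : Qᵀ * Q = 1) (X : Matrix (Fin k) (Fin n) ℝ) :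
    frobSq (A - Q * (Qᵀ * A)) ≤ frobSq (A - Q * X) := by
  set D := A - Q * (Qᵀ * A) with hD
  have hDQ : Dᵀ * Q = 0 := by
    have : Qᵀ * D = 0 := by
      rw [hD, Matrix.mul_sub, ← Matrix.mul_assoc, hQ, Matrix.one_mul, sub_self]
    simpa using congrArg Matrix.transpose this
  have hsplit : A - Q * X = D + Q * (Qᵀ * A - X) := by rw [hD, Matrix.mul_sub]; abel
  rw [hsplit, frobSq_add_of_transpose_mul_eq_zero (by
    rw [← Matrix.mul_assoc, hDQ, Matrix.zero_mul])]
  exact le_add_of_nonneg_right (frobSq_nonneg _)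

theorem exists_orthonormal_range_factorization {m n : ℕ} (B : Matrix (Fin m) (Fin n) ℝ) :
    ∃ (U : Matrix (Fin m) (Fin B.rank) ℝ) (Y : Matrix (Fin B.rank) (Fin n) ℝ),
      Uᵀ * U = 1 ∧ B = U * Y := by
  let c : Fin n → EuclideanSpace ℝ (Fin m) := fun j => WithLp.toLp 2 (B.col j)
  let K : Submodule ℝ (EuclideanSpace ℝ (Fin m)) := Submodule.span ℝ (Set.range c)
  have hK : Module.finrank ℝ K = B.rank := by
    rw [Matrix.rank_eq_finrank_span_cols,
      ← LinearEquiv.finrank_map_eq (WithLp.linearEquiv 2 ℝ (Fin m → ℝ)).symm, Submodule.map_span,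
      ← Set.range_comp]
    rfl
  let u := (stdOrthonormalBasis ℝ K).reindex (finCongr hK)
  have hmem (j : Fin n) : c j ∈ K := Submodule.subset_span ⟨j, rfl⟩
  refine ⟨Matrix.of fun i a => (u a : EuclideanSpace ℝ (Fin m)) i,
    Matrix.of fun a j => inner ℝ (u a) (⟨c j, hmem j⟩ : K), ?_, ?_⟩
  · ext a b
    have := orthonormal_iff_ite.1 u.orthonormal a b
    rw [Submodule.coe_inner, PiLp.inner_apply] at this
    simpa [Matrix.mul_apply, Matrix.one_apply, mul_comm] using this
  · ext i j
    have := congrArg (fun v : K => (v : EuclideanSpace ℝ (Fin m)) i)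
      (u.sum_repr' (⟨c j, hmem j⟩ : K))
    simpa [Matrix.mul_apply, c, mul_comm] using this.symm

/-- Mean error of the Gaussian range finder, against a fixed competitor `B` of small rank. -/
theorem lintegral_frobSq_sub_proj_le {m n k r : ℕ} (A : Matrix (Fin m) (Fin n) ℝ)
    {Q : Matrix (Fin n) (Fin k) ℝ → Matrix (Fin m) (Fin k) ℝ}
    (hQorth : ∀ Ω, (Q Ω)ᵀ * Q Ω = 1)
    (hQrange : ∀ Ω, ∃ M : Matrix (Fin k) (Fin k) ℝ, A * Ω = Q Ω * M)
    (hr : r + 1 < k) {B : Matrix (Fin m) (Fin n) ℝ} (hB : B.rank < r + 1) :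
    ∫⁻ Ω, ENNReal.ofReal (frobSq (A - Q Ω * ((Q Ω)ᵀ * A))) ∂(gaussMatrix n k)
      ≤ ENNReal.ofReal ((1 + (r : ℝ) / ((k : ℝ) - r - 1)) * frobSq (A - B)) := by
  obtain ⟨V, Y, hV, hBV⟩ := exists_orthonormal_range_factorization Bᵀ
  have hsr : Bᵀ.rank ≤ r := by rw [Matrix.rank_transpose]; omega
  have hsr' : (Bᵀ.rank : ℝ) ≤ r := by exact_mod_cast hsr
  have hrk : (0 : ℝ) < (k : ℝ) - r - 1 := by
    have : ((r + 1 : ℕ) : ℝ) < k := by exact_mod_cast hr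
    push_cast at this
    linarith
  let f : Matrix (Fin k) (Fin n) ℝ → ENNReal := fun G =>
    ENNReal.ofReal (frobSq (Aᵀ - V * (((G * V)ᵀ * (G * V))⁻¹ * (G * V)ᵀ * (G * Aᵀ))))
  have hGV : Measurable fun G : Matrix (Fin k) (Fin n) ℝ => G * V :=
    measurable_id.matrix_mul measurable_const
  have hpinv : Measurable fun G : Matrix (Fin k) (Fin n) ℝ =>
      V * (((G * V)ᵀ * (G * V))⁻¹ * (G * V)ᵀ * (G * Aᵀ)) :=
    measurable_const.matrix_mul (((hGV.matrix_transpose.matrix_mul hGV).matrix_inv.matrix_mul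
      hGV.matrix_transpose).matrix_mul (measurable_id.matrix_mul measurable_const))
  have hf : Measurable f := by
    refine Measurable.ennreal_ofReal (Measurable.frobSq (measurable_matrix_iff.2 fun i j => ?_))
    exact measurable_const.sub (measurable_matrix_iff.1 hpinv i j)
  have hle (Ω : Matrix (Fin n) (Fin k) ℝ) :
      ENNReal.ofReal (frobSq (A - Q Ω * ((Q Ω)ᵀ * A))) ≤ f Ωᵀ := by
    obtain ⟨M, hM⟩ := hQrange Ω
    refine ENNReal.ofReal_le_ofReal ?_
    rw [← frobSq_transpose (Aᵀ - _), transpose_sub, transpose_transpose, transpose_mul,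
      transpose_mul, transpose_mul Ωᵀ, transpose_transpose, transpose_transpose, hM,
      Matrix.mul_assoc, Matrix.mul_assoc]
    exact frobSq_sub_proj_le A (hQorth Ω) _
  calc _ ≤ ∫⁻ Ω, f Ωᵀ ∂(gaussMatrix n k) := lintegral_mono hle
    _ = ∫⁻ G, f G ∂(gaussMatrix k n) :=
        (measurePreserving_transpose_gaussMatrix n k).lintegral_comp hf
    _ ≤ ENNReal.ofReal ((1 + (Bᵀ.rank : ℝ) / ((k : ℝ) - Bᵀ.rank - 1)) *
          frobSq (Aᵀ - V * (Vᵀ * Aᵀ))) :=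
        lintegral_frobSq_sub_sketch_le (by omega) Aᵀ hV
    _ ≤ _ := by
        have hAB : frobSq (Aᵀ - V * (Vᵀ * Aᵀ)) ≤ frobSq (A - B) := by
          rw [← frobSq_transpose (A - B), transpose_sub]
          conv_rhs => rw [hBV]
          exact frobSq_sub_proj_le Aᵀ hV Y
        have := frobSq_nonneg (Aᵀ - V * (Vᵀ * Aᵀ))
        gcongr

/-- **Theorem 4.1 (Frobenius-norm error of the sketched low-rank approximation), real
case.**  Sketch with independent standard normal `Ω ∈ ℝ^{n×k}`, `Ψ ∈ ℝ^{ℓ×m}`, where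
`k ≤ min(m,n)`, `ℓ ≤ m`, `ℓ > k + 1`.  Let `Q(Ω)` be a measurable choice of a matrix
with orthonormal columns whose column space contains that of `AΩ`, and set
`X = (ΨQ)† Ψ A` and `Â = Q X`.  Then for every `ϱ < k - 1`:
`E ‖A - Â‖_F² ≤ (1 + k/(ℓ-k-1)) (1 + ϱ/(k-ϱ-1)) τ_{ϱ+1}(A)²`. -/
theorem sketched_low_rank_approx_frobenius_error {m n k ℓ : ℕ}
    (hkm : k ≤ m) (hkn : k ≤ n) (hℓm : ℓ ≤ m) (hℓ : k + 1 < ℓ)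
    (A : Matrix (Fin m) (Fin n) ℝ)
    (Q : Matrix (Fin n) (Fin k) ℝ → Matrix (Fin m) (Fin k) ℝ)
    (hQmeas : Measurable Q)
    (hQorth : ∀ Ω, (Q Ω)ᵀ * Q Ω = 1)
    (hQrange : ∀ Ω, ∃ M : Matrix (Fin k) (Fin k) ℝ, A * Ω = Q Ω * M)
    (ϱ : ℕ) (hϱ : ϱ + 1 < k) :
    ∫ p, frobSq (A - Q p.1 *
        (((p.2 * Q p.1)ᵀ * (p.2 * Q p.1))⁻¹ * (p.2 * Q p.1)ᵀ * (p.2 * A)))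
        ∂((gaussMatrix n k).prod (gaussMatrix ℓ m))
      ≤ (1 + (k : ℝ) / ((ℓ : ℝ) - k - 1)) * (1 + (ϱ : ℝ) / ((k : ℝ) - ϱ - 1))
        * tailEnergySq A (ϱ + 1) := by
  have hk : (0 : ℝ) < (k : ℝ) - ϱ - 1 := by
    have : ((ϱ + 1 : ℕ) : ℝ) < k := by exact_mod_cast hϱ
    push_cast at this
    linarith
  have hl : (0 : ℝ) < (ℓ : ℝ) - k - 1 := by
    have : ((k + 1 : ℕ) : ℝ) < ℓ := by exact_mod_cast hℓ
    push_cast at this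
    linarith
  set a : ℝ := 1 + (k : ℝ) / ((ℓ : ℝ) - k - 1) with ha
  set b : ℝ := 1 + (ϱ : ℝ) / ((k : ℝ) - ϱ - 1) with hb
  have ha0 : 0 < a := by positivity
  have hb0 : 0 < b := by positivity
  by_cases hint : Integrable (fun p : Matrix (Fin n) (Fin k) ℝ × Matrix (Fin ℓ) (Fin m) ℝ =>
      frobSq (A - Q p.1 *
        (((p.2 * Q p.1)ᵀ * (p.2 * Q p.1))⁻¹ * (p.2 * Q p.1)ᵀ * (p.2 * A))))
      ((gaussMatrix n k).prod (gaussMatrix ℓ m))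
  swap
  · rw [integral_undef hint]
    refine mul_nonneg (by positivity) (Real.sInf_nonneg ?_)
    rintro x ⟨B, -, rfl⟩
    exact frobSq_nonneg _
  have hbound (B : Matrix (Fin m) (Fin n) ℝ) (hB : B.rank < ϱ + 1) :
      ∫ p, frobSq (A - Q p.1 *
        (((p.2 * Q p.1)ᵀ * (p.2 * Q p.1))⁻¹ * (p.2 * Q p.1)ᵀ * (p.2 * A)))
        ∂((gaussMatrix n k).prod (gaussMatrix ℓ m)) ≤ a * b * frobSq (A - B) := by
    rw [integral_eq_lintegral_of_nonneg_ae (ae_of_all _ fun _ => frobSq_nonneg _)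
      hint.aestronglyMeasurable]
    refine ENNReal.toReal_le_of_le_ofReal (mul_nonneg (by positivity) (frobSq_nonneg _)) ?_
    refine (lintegral_prod_le _).trans ?_
    calc _ ≤ ∫⁻ Ω, ENNReal.ofReal (a * frobSq (A - Q Ω * ((Q Ω)ᵀ * A))) ∂(gaussMatrix n k) :=
          lintegral_mono fun Ω => lintegral_frobSq_sub_sketch_le hℓ A (hQorth Ω)
      _ = ENNReal.ofReal a *
          ∫⁻ Ω, ENNReal.ofReal (frobSq (A - Q Ω * ((Q Ω)ᵀ * A))) ∂(gaussMatrix n k) := by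
          simp only [ENNReal.ofReal_mul ha0.le]
          exact lintegral_const_mul' _ _ ENNReal.ofReal_ne_top
      _ ≤ ENNReal.ofReal a * ENNReal.ofReal (b * frobSq (A - B)) := by
          gcongr
          exact lintegral_frobSq_sub_proj_le A hQorth hQrange hϱ hB
      _ = _ := by rw [← ENNReal.ofReal_mul ha0.le, mul_assoc]
  rw [← div_le_iff₀' (by positivity)]
  refine le_csInf ⟨_, 0, by simp, rfl⟩ ?_
  rintro x ⟨B, hB, rfl⟩
  rw [div_le_iff₀' (by positivity)]
  exact hbound B hB
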